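/- arXiv:2412.12130 — 3 statements merged into one kernel-verified Lean document; each statement's English description precedes it below -/
import Mathlib

section
/- Let k ≥ 2 and let x, n be positive integers. Then there exists a real number η_n with (L_n^{(k)})^x = f_k(α)^x (2α − 1)^x α^{(n−1)x} (1 + η_n) and |η_n| < 1.5·x·e^{1.5x/α^{n−1}} / α^{n−1}. -/
/-- Auxiliary: `lucasAux k j` is the `k`-generalized Lucas number `L^{(k)}_{j + 2 - k}`. -/
def lucasAux (k : ℕ) : ℕ → ℤ
  | j =>
    if _h1 : j < k - 2 then 0
    else if _h2 : j = k - 2 then 2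
    else if _h3 : j = k - 1 then 1
    else ∑ i ∈ Finset.range k, lucasAux k (j - (i + 1))
termination_by j => j
decreasing_by omega

/-- The `k`-generalized Lucas sequence, indexed by the integers:
`L_{2-k} = ⋯ = L_{-1} = 0`, `L_0 = 2`, `L_1 = 1`, and
`L_n = L_{n-1} + ⋯ + L_{n-k}` for `n ≥ 2`; moreover `L_{-1} = -1` when `k = 2`
(the backwards extension of the recurrence). -/
def genLucas (k : ℕ) (n : ℤ) : ℤ :=
  if k = 2 ∧ n = -1 then -1
  else if 2 - (k : ℤ) ≤ n then lucasAux k (n - (2 - (k : ℤ))).toNat else 0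

/-- `f_k(x) = (x - 1)/(2 + (k + 1)(x - 2))`. -/
noncomputable def fk (k : ℕ) (x : ℝ) : ℝ := (x - 1) / (2 + ((k : ℝ) + 1) * (x - 2))

open Finset in
/-- The recurrence of the shifted `k`-generalized Lucas sequence. -/
theorem lucasAux_add (k j : ℕ) (hk : 2 ≤ k) :
    lucasAux k (j + k) = ∑ i ∈ range k, lucasAux k (j + i) := by
  rw [lucasAux, dif_neg (by omega), dif_neg (by omega), dif_neg (by omega),
    ← sum_range_reflect (fun i => lucasAux k (j + i))]
  refine sum_congr rfl fun i hi => ?_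
  rw [mem_range] at hi
  congr 1
  omega

theorem lucasAux_of_lt (k j : ℕ) (hj : j < k - 2) : lucasAux k j = 0 := by
  rw [lucasAux, dif_pos hj]

theorem lucasAux_sub_two (k : ℕ) : lucasAux k (k - 2) = 2 := by
  rw [lucasAux, dif_neg (by omega), dif_pos rfl]

theorem lucasAux_sub_one (k : ℕ) (hk : 2 ≤ k) : lucasAux k (k - 1) = 1 := by
  rw [lucasAux, dif_neg (by omega), dif_neg (by omega), dif_pos rfl]

section DominantRoot

variable {k : ℕ} {α : ℝ}

open Finset

theorem pow_mul_two_sub_eq_one (hroot : α ^ k = ∑ i ∈ range k, α ^ i) :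
    α ^ k * (2 - α) = 1 := by
  have h := geom_sum_mul α k
  rw [← hroot] at h
  linarith

theorem inv_pow_eq_two_sub (hroot : α ^ k = ∑ i ∈ range k, α ^ i) :
    α⁻¹ ^ k = 2 - α := by
  have h := pow_mul_two_sub_eq_one hroot
  rw [inv_pow]
  exact inv_eq_of_mul_eq_one_right h

theorem lt_two_of_root (hα : 1 < α) (hroot : α ^ k = ∑ i ∈ range k, α ^ i) : α < 2 := by
  have h := inv_pow_eq_two_sub hroot
  have : 0 < α⁻¹ ^ k := by positivity
  linarith

theorem sum_inv_pow_succ_eq_one (hα : 1 < α) (hroot : α ^ k = ∑ i ∈ range k, α ^ i) :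
    ∑ i ∈ range k, α⁻¹ ^ (i + 1) = 1 := by
  have h := geom_sum_mul α⁻¹ k
  rw [inv_pow_eq_two_sub hroot] at h
  have hinv : α⁻¹ < 1 := inv_lt_one_of_one_lt₀ hα
  have hmul : α⁻¹ * α = 1 := inv_mul_cancel₀ (by positivity)
  simp_rw [pow_succ]
  rw [← sum_mul]
  apply mul_right_cancel₀ (sub_ne_zero.mpr hinv.ne)
  linear_combination α⁻¹ * h - hmul

theorem mul_two_sub_le (hk : 2 ≤ k) (hα : 1 < α) (hroot : α ^ k = ∑ i ∈ range k, α ^ i) :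
    k * (2 - α) ≤ 3 - α - α⁻¹ := by
  obtain ⟨m, rfl⟩ : ∃ m, k = m + 1 := ⟨k - 1, by omega⟩
  have hβ := inv_pow_eq_two_sub hroot
  have hpos : 0 < 2 - α := by linarith [lt_two_of_root hα hroot]
  have hone := pow_mul_two_sub_eq_one hroot
  have hmul : α⁻¹ * α = 1 := inv_mul_cancel₀ (by positivity)
  have hsum : (m : ℝ) ≤ ∑ i ∈ range m, α ^ i := by
    have := card_nsmul_le_sum (range m) (fun i => α ^ i) 1 fun i _ => one_le_pow₀ hα.le
    simpa using this
  rw [sum_range_succ] at hroot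
  have h := mul_le_mul_of_nonneg_right hsum hpos.le
  have hinv : α ^ m * (2 - α) = α⁻¹ := by
    rw [pow_succ] at hone
    linear_combination α⁻¹ * hone - α ^ m * (2 - α) * hmul
  have hs : (∑ i ∈ range m, α ^ i) * (2 - α) = 1 - α⁻¹ := by
    linear_combination hone - hinv - (2 - α) * hroot
  push_cast
  linarith

/-- Any solution of the `k`-bonacci recurrence is multiplied by `α` under the shift, after applying
the linear functional which kills the non-dominant roots. -/
theorem sum_functional_succ (hα : 1 < α) (hroot : α ^ k = ∑ i ∈ range k, α ^ i) {u : ℕ → ℝ}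
    (hu : ∀ j, u (j + k) = ∑ i ∈ range k, u (j + i)) (j : ℕ) :
    ∑ i ∈ range k, (1 - α⁻¹ ^ (i + 1)) * u (j + 1 + i) =
      α * ∑ i ∈ range k, (1 - α⁻¹ ^ (i + 1)) * u (j + i) := by
  have hmul : α * α⁻¹ = 1 := mul_inv_cancel₀ (by positivity)
  have h₁ : ∑ i ∈ range k, (1 - α⁻¹ ^ (i + 1)) * u (j + 1 + i) =
      ∑ i ∈ range k, (1 - α⁻¹ ^ i) * u (j + i) + (1 - α⁻¹ ^ k) * u (j + k) := by
    rw [← sum_range_succ (fun i => (1 - α⁻¹ ^ i) * u (j + i)), sum_range_succ']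
    simp [add_assoc, add_comm 1]
  have h₂ : α * ∑ i ∈ range k, (1 - α⁻¹ ^ (i + 1)) * u (j + i) =
      ∑ i ∈ range k, (1 - α⁻¹ ^ i) * u (j + i) + (α - 1) * ∑ i ∈ range k, u (j + i) := by
    rw [mul_sum, mul_sum, ← sum_add_distrib]
    refine sum_congr rfl fun i _ => ?_
    rw [pow_succ]
    linear_combination - α⁻¹ ^ i * u (j + i) * hmul
  rw [h₁, h₂, ← hu, inv_pow_eq_two_sub hroot]
  ring

/-- A solution of the `k`-bonacci recurrence with no `α`-component is a convex combination of its
previous `k` values, hence obeys any strict bound satisfied by its initial values. -/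
theorem abs_lt_of_functional_eq_zero (hk : 0 < k) (hα : 1 < α)
    (hroot : α ^ k = ∑ i ∈ range k, α ^ i) {u : ℕ → ℝ}
    (hu : ∀ j, u (j + k) = ∑ i ∈ range k, u (j + i))
    (h0 : ∑ i ∈ range k, (1 - α⁻¹ ^ (i + 1)) * u i = 0) {M : ℝ}
    (hM : ∀ j < k, |u j| < M) (j : ℕ) : |u j| < M := by
  have hzero : ∀ j, ∑ i ∈ range k, (1 - α⁻¹ ^ (i + 1)) * u (j + i) = 0 := by
    intro j
    induction j with
    | zero => simpa using h0
    | succ j ih => rw [sum_functional_succ hα hroot hu, ih, mul_zero]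
  induction j using Nat.strong_induction_on with
  | _ j ih =>
    rcases lt_or_ge j k with hj | hj
    · exact hM j hj
    obtain ⟨l, rfl⟩ := Nat.exists_eq_add_of_le' hj
    have hconv : u (l + k) = ∑ i ∈ range k, α⁻¹ ^ (i + 1) * u (l + i) := by
      have h := hzero l
      simp_rw [sub_mul, one_mul] at h
      rw [sum_sub_distrib, ← hu] at h
      linarith
    calc |u (l + k)| ≤ ∑ i ∈ range k, α⁻¹ ^ (i + 1) * |u (l + i)| := by
          rw [hconv]
          refine (abs_sum_le_sum_abs _ _).trans_eq (sum_congr rfl fun i _ => ?_)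
          rw [abs_mul, abs_of_pos (by positivity : 0 < α⁻¹ ^ (i + 1))]
      _ < ∑ i ∈ range k, α⁻¹ ^ (i + 1) * M := by
          refine sum_lt_sum_of_nonempty (nonempty_range_iff.mpr hk.ne') fun i hi => ?_
          rw [mem_range] at hi
          exact mul_lt_mul_of_pos_left (ih _ (by omega)) (by positivity)
      _ = M := by rw [← sum_mul, sum_inv_pow_succ_eq_one hα hroot, one_mul]

theorem le_fk_denom (hk : 2 ≤ k) (hα : 1 < α) (hroot : α ^ k = ∑ i ∈ range k, α ^ i) :
    (α - 1) * (2 * α - 1) ≤ α * (2 + ((k : ℝ) + 1) * (α - 2)) := by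
  have h := mul_le_mul_of_nonneg_left (mul_two_sub_le hk hα hroot) (by linarith : 0 ≤ α)
  have hmul : α * α⁻¹ = 1 := mul_inv_cancel₀ (by positivity)
  linear_combination h - hmul

theorem fk_denom_pos (hk : 2 ≤ k) (hα : 1 < α) (hroot : α ^ k = ∑ i ∈ range k, α ^ i) :
    0 < 2 + ((k : ℝ) + 1) * (α - 2) := by
  have h : 0 < α * (2 + ((k : ℝ) + 1) * (α - 2)) :=
    (mul_pos (by linarith) (by linarith)).trans_le (le_fk_denom hk hα hroot)
  exact pos_of_mul_pos_right h (by linarith)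

theorem one_le_fk_mul (hk : 2 ≤ k) (hα : 1 < α) (hroot : α ^ k = ∑ i ∈ range k, α ^ i) :
    1 ≤ fk k α * (2 * α - 1) := by
  rw [fk, div_mul_eq_mul_div, one_le_div (fk_denom_pos hk hα hroot)]
  have hk' : (2 : ℝ) ≤ k := by exact_mod_cast hk
  have h := mul_le_mul_of_nonneg_right hk' (by linarith [lt_two_of_root hα hroot] : 0 ≤ 2 - α)
  nlinarith [sq_nonneg (2 * α - 3)]

theorem fk_mul_le (hk : 2 ≤ k) (hα : 1 < α) (hroot : α ^ k = ∑ i ∈ range k, α ^ i) :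
    fk k α * (2 * α - 1) ≤ α := by
  rw [fk, div_mul_eq_mul_div, div_le_iff₀ (fk_denom_pos hk hα hroot)]
  exact le_fk_denom hk hα hroot

theorem functional_pow (hα : 1 < α) (hroot : α ^ k = ∑ i ∈ range k, α ^ i) :
    ∑ i ∈ range k, (1 - α⁻¹ ^ (i + 1)) * α ^ i = α ^ k - k * α⁻¹ := by
  have hα0 : α ≠ 0 := by positivity
  have h : ∀ i ∈ range k, (1 - α⁻¹ ^ (i + 1)) * α ^ i = α ^ i - α⁻¹ := by
    intro i _
    rw [pow_succ, sub_mul, one_mul, mul_right_comm, ← mul_pow, inv_mul_cancel₀ hα0, one_pow,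
      one_mul]
  rw [sum_congr rfl h, sum_sub_distrib, ← hroot]
  simp

theorem functional_lucasAux (hk : 2 ≤ k) (hα : 1 < α)
    (hroot : α ^ k = ∑ i ∈ range k, α ^ i) :
    ∑ i ∈ range k, (1 - α⁻¹ ^ (i + 1)) * (lucasAux k i : ℝ) = (α - 1) * (2 * α - 1) := by
  obtain ⟨m, rfl⟩ : ∃ m, k = m + 2 := ⟨k - 2, by omega⟩
  have hβ := inv_pow_eq_two_sub hroot
  have hmul : α * α⁻¹ = 1 := mul_inv_cancel₀ (by positivity)
  have h₀ : ∑ i ∈ range m, (1 - α⁻¹ ^ (i + 1)) * (lucasAux (m + 2) i : ℝ) = 0 := by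
    refine sum_eq_zero fun i hi => ?_
    rw [lucasAux_of_lt _ _ (by simpa using hi)]
    simp
  have h₁ : lucasAux (m + 2) m = 2 := lucasAux_sub_two (m + 2)
  have h₂ : lucasAux (m + 2) (m + 1) = 1 := lucasAux_sub_one (m + 2) hk
  have h₃ : α⁻¹ ^ (m + 1) = α * (2 - α) := by
    rw [← hβ, pow_succ _ (m + 1)]
    linear_combination - α⁻¹ ^ (m + 1) * hmul
  rw [sum_range_succ, sum_range_succ, h₀, h₁, h₂, h₃, hβ]
  push_cast
  ring

theorem abs_lucasAux_sub_lt (hk : 2 ≤ k) (hα : 1 < α)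
    (hroot : α ^ k = ∑ i ∈ range k, α ^ i) (j : ℕ) :
    |(lucasAux k j : ℝ) - fk k α * (2 * α - 1) / α ^ (k - 1) * α ^ j| < 3 / 2 := by
  have hα0 : 0 < α := by linarith
  have hα2 := lt_two_of_root hα hroot
  have hD := fk_denom_pos hk hα hroot
  have hA1 := one_le_fk_mul hk hα hroot
  have hA2 := fk_mul_le hk hα hroot
  have hAD : fk k α * (2 * α - 1) * (2 + ((k : ℝ) + 1) * (α - 2)) = (α - 1) * (2 * α - 1) := by
    rw [fk]
    field_simp
  set A := fk k α * (2 * α - 1)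
  refine abs_lt_of_functional_eq_zero (u := fun j => (lucasAux k j : ℝ) - A / α ^ (k - 1) * α ^ j)
    (by omega) hα hroot ?_ ?_ ?_ j
  · intro j
    rw [lucasAux_add k j hk, sum_sub_distrib, ← mul_sum]
    simp_rw [pow_add α j]
    rw [← mul_sum, ← hroot]
    push_cast
    rfl
  · simp_rw [mul_sub]
    rw [sum_sub_distrib, functional_lucasAux hk hα hroot]
    have h : ∀ i ∈ range k, (1 - α⁻¹ ^ (i + 1)) * (A / α ^ (k - 1) * α ^ i) =
        A / α ^ (k - 1) * ((1 - α⁻¹ ^ (i + 1)) * α ^ i) := fun i _ => by ring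
    rw [sum_congr rfl h, ← mul_sum, functional_pow hα hroot, ← hAD]
    have hβ := inv_pow_eq_two_sub hroot
    obtain ⟨m, rfl⟩ : ∃ m, k = m + 1 := ⟨k - 1, by omega⟩
    rw [Nat.add_sub_cancel, pow_succ, div_eq_mul_inv]
    rw [pow_succ, inv_pow] at hβ
    have hm : (α ^ m)⁻¹ * α ^ m = 1 := inv_mul_cancel₀ (by positivity)
    push_cast
    linear_combination A * (m + 1) * hβ - A * α * hm
  · intro j hj
    obtain ⟨m, rfl⟩ : ∃ m, k = m + 2 := ⟨k - 2, by omega⟩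
    have hA0 : 0 < A := by linarith
    rcases lt_trichotomy j m with h | rfl | h
    · have hle : A / α ^ (m + 2 - 1) * α ^ j ≤ 1 := by
        rw [div_mul_eq_mul_div, div_le_one (by positivity)]
        calc A * α ^ j ≤ α * α ^ j := by gcongr
          _ = α ^ (j + 1) := by ring
          _ ≤ α ^ (m + 2 - 1) := pow_le_pow_right₀ hα.le (by omega)
      have hpos : 0 < A / α ^ (m + 2 - 1) * α ^ j := by positivity
      simp only [lucasAux_of_lt (m + 2) j (by simpa using h), Int.cast_zero]
      rw [abs_lt]
      constructor <;> linarith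
    · have h₁ : lucasAux (j + 2) j = 2 := lucasAux_sub_two (j + 2)
      have h₂ : A / α ^ (j + 2 - 1) * α ^ j = A / α := by
        rw [show j + 2 - 1 = j + 1 by omega, pow_succ]
        field_simp
      have h₃ : A / α ≤ 1 := (div_le_one hα0).mpr hA2
      have h₄ : 1 / 2 < A / α := by
        rw [lt_div_iff₀ hα0]
        linarith
      simp only [h₁, h₂]
      push_cast
      rw [abs_lt]
      constructor <;> linarith
    · obtain rfl : j = m + 1 := by omega
      have h₁ : lucasAux (m + 2) (m + 1) = 1 := lucasAux_sub_one (m + 2) hk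
      have h₂ : A / α ^ (m + 2 - 1) * α ^ (m + 1) = A := by
        rw [show m + 2 - 1 = m + 1 by omega]
        field_simp
      simp only [h₁, h₂]
      push_cast
      rw [abs_lt]
      constructor <;> linarith

theorem abs_genLucas_sub_lt (hk : 2 ≤ k) (hα : 1 < α)
    (hroot : α ^ k = ∑ i ∈ range k, α ^ i) {n : ℕ} (hn : 1 ≤ n) :
    |(genLucas k n : ℝ) - fk k α * (2 * α - 1) * α ^ (n - 1)| < 3 / 2 := by
  have h := abs_lucasAux_sub_lt hk hα hroot (n - 1 + (k - 1))
  have hα0 : 0 < α := by linarith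
  have hL : genLucas k n = lucasAux k (n - 1 + (k - 1)) := by
    rw [genLucas, if_neg (by omega), if_pos (by omega)]
    congr 1
    omega
  rw [hL]
  convert h using 3
  rw [pow_add]
  field_simp

end DominantRoot

theorem abs_one_add_pow_sub_one_le (t : ℝ) (x : ℕ) :
    |(1 + t) ^ x - 1| ≤ x * |t| * Real.exp (x * |t|) := by
  have h₁ : |(1 + t) ^ x - 1| ≤ (1 + |t|) ^ x - 1 := by
    induction x with
    | zero => simp
    | succ x ih =>
      have hpow : |(1 + t) ^ x| ≤ (1 + |t|) ^ x := by
        rw [abs_pow]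
        gcongr
        simpa using abs_add_le 1 t
      calc |(1 + t) ^ (x + 1) - 1| = |((1 + t) ^ x - 1) + (1 + t) ^ x * t| := by ring_nf
        _ ≤ |(1 + t) ^ x - 1| + |(1 + t) ^ x| * |t| := by
            rw [← abs_mul]
            exact abs_add_le _ _
        _ ≤ ((1 + |t|) ^ x - 1) + (1 + |t|) ^ x * |t| := by gcongr
        _ = (1 + |t|) ^ (x + 1) - 1 := by ring
  have h₂ : (1 + |t|) ^ x ≤ Real.exp (x * |t|) := by
    rw [Real.exp_nat_mul]
    gcongr
    linarith [Real.add_one_le_exp |t|]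
  have h₃ : Real.exp (x * |t|) - 1 ≤ x * |t| * Real.exp (x * |t|) := by
    have h := mul_le_mul_of_nonneg_right (Real.add_one_le_exp (-(x * |t|)))
      (Real.exp_pos (x * |t|)).le
    rw [← Real.exp_add, neg_add_cancel, Real.exp_zero] at h
    linarith
  linarith

theorem gen_lucas_pow_approx (k n x : ℕ) (hk : 2 ≤ k) (hn : 1 ≤ n) (hx : 1 ≤ x)
    (α : ℝ) (hα : 1 < α) (hroot : α ^ k = ∑ i ∈ Finset.range k, α ^ i) :
    ∃ η : ℝ, ((genLucas k (n : ℤ) : ℝ)) ^ x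
        = (fk k α) ^ x * (2 * α - 1) ^ x * α ^ ((n - 1) * x) * (1 + η) ∧
      |η| < 1.5 * x * Real.exp (1.5 * x / α ^ (n - 1)) / α ^ (n - 1) := by
  have herr := abs_genLucas_sub_lt hk hα hroot hn
  have hA := one_le_fk_mul hk hα hroot
  have hp : 0 < α ^ (n - 1) := by positivity
  have hx0 : (0 : ℝ) < x := by exact_mod_cast hx
  rw [pow_mul, ← mul_pow, ← mul_pow]
  set A := fk k α * (2 * α - 1)
  set p := α ^ (n - 1)
  set L := (genLucas k (n : ℤ) : ℝ)
  have hAp : 0 < A * p := by positivity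
  obtain ⟨t, ht⟩ : ∃ t, t = (L - A * p) / (A * p) := ⟨_, rfl⟩
  have hL : L = A * p * (1 + t) := by
    rw [ht]
    field_simp
    ring
  have htlt : |t| < 1.5 / p := by
    rw [ht, abs_div, abs_of_pos hAp, div_lt_div_iff₀ hAp hp]
    have h : p ≤ A * p := le_mul_of_one_le_left hp.le hA
    nlinarith
  refine ⟨(1 + t) ^ x - 1, ?_, ?_⟩
  · rw [hL, mul_pow]
    ring
  · calc |(1 + t) ^ x - 1| ≤ x * |t| * Real.exp (x * |t|) := abs_one_add_pow_sub_one_le t x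
      _ ≤ x * |t| * Real.exp (x * (1.5 / p)) := by gcongr
      _ < x * (1.5 / p) * Real.exp (x * (1.5 / p)) := by gcongr
      _ = 1.5 * x * Real.exp (1.5 * x / p) / p := by
          rw [show (x : ℝ) * (1.5 / p) = 1.5 * x / p by ring]
          ring
end

section
/- Let k ≥ 2. The only solutions in nonnegative integers n, m of L_{n+1}^{(k)} + L_n^{(k)} − L_{n−1}^{(k)} = L_m^{(k)} (with L_{−1}^{(2)} = −1 when k = 2 and n = 0) are (n, m) = (1, 0) for every k ≥ 2, (n, m) = (0, 2) for every k ≥ 3, and (n, m) = (0, 3) when k = 2. -/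
theorem lucasAux_zero (t : ℕ) : lucasAux (t + 2) t = 2 := by
  rw [lucasAux]; simp

theorem lucasAux_one (t : ℕ) : lucasAux (t + 2) (t + 1) = 1 := by
  rw [lucasAux]; simp

theorem lucasAux_of_lt_s11 (t j : ℕ) (h : j < t) : lucasAux (t + 2) j = 0 := by
  rw [lucasAux]; simp [h]

theorem lucasAux_add_two (t n : ℕ) :
    lucasAux (t + 2) (t + n + 2) = lucasAux (t + 2) (t + n + 1) + lucasAux (t + 2) (t + n) +
      ∑ i ∈ Finset.range t, lucasAux (t + 2) (t + n - (i + 1)) := by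
  rw [lucasAux, dif_neg (by omega), dif_neg (by omega), dif_neg (by omega),
    Finset.sum_range_succ', Finset.sum_range_succ']
  have h : ∀ i, t + n + 2 - (i + 1 + 1 + 1) = t + n - (i + 1) := by omega
  simp only [h]
  rw [show t + n + 2 - (0 + 1 + 1) = t + n by omega, show t + n + 2 - (0 + 1) = t + n + 1 by omega]
  ring

theorem lucasAux_nonneg (k j : ℕ) : 0 ≤ lucasAux k j := by
  induction j using Nat.strong_induction_on with
  | _ j ih =>
    rw [lucasAux]
    split_ifs with h1 h2 h3
    · simp
    · simp
    · simp
    · exact Finset.sum_nonneg fun i _ => ih _ (by omega)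

theorem lucasAux_two (t : ℕ) : lucasAux (t + 2) (t + 2) = 3 := by
  have h := lucasAux_add_two t 0
  rw [Finset.sum_eq_zero] at h
  · simpa [lucasAux_zero, lucasAux_one] using h
  · intro i hi
    rw [Finset.mem_range] at hi
    exact lucasAux_of_lt_s11 t _ (by omega)

theorem lucasAux_add_le (t n : ℕ) :
    lucasAux (t + 2) (t + n + 1) + lucasAux (t + 2) (t + n) ≤ lucasAux (t + 2) (t + n + 2) := by
  rw [lucasAux_add_two]
  exact le_add_of_nonneg_right (Finset.sum_nonneg fun i _ => lucasAux_nonneg _ _)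

theorem genLucas_natCast (t n : ℕ) : genLucas (t + 2) (n : ℤ) = lucasAux (t + 2) (t + n) := by
  rw [genLucas, if_neg (by omega), if_pos (by push_cast; omega)]
  congr 1
  push_cast
  omega

theorem genLucas_two_neg_one : genLucas 2 (-1) = -1 := by
  simp [genLucas]

theorem genLucas_neg_one (t : ℕ) (ht : 1 ≤ t) : genLucas (t + 2) (-1) = 0 := by
  rw [genLucas, if_neg (by omega), if_pos (by push_cast; omega)]
  exact lucasAux_of_lt_s11 t _ (by push_cast; omega)

/-- A sequence starting `2, 1, 3` that grows at least as fast as the Fibonacci recurrence is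
positive and strictly increasing from index `1` on. -/
theorem pos_and_strictMono_of_add_le {a : ℕ → ℤ} (h0 : a 0 = 2) (h1 : a 1 = 1)
    (h : ∀ n, a (n + 1) + a n ≤ a (n + 2)) :
    (∀ n, 0 < a n) ∧ StrictMono fun n => a (n + 1) := by
  have hpos : ∀ n, 0 < a n ∧ 0 < a (n + 1) := by
    intro n
    induction n with
    | zero => simp [h0, h1]
    | succ n ih => exact ⟨ih.2, by linarith [h n]⟩
  exact ⟨fun n => (hpos n).1, strictMono_nat_of_lt_succ fun n => by linarith [h n, (hpos n).1]⟩

theorem gen_lucas_linear_eq_solutions (k n m : ℕ) (hk : 2 ≤ k) :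
    genLucas k ((n : ℤ) + 1) + genLucas k (n : ℤ) - genLucas k ((n : ℤ) - 1)
        = genLucas k (m : ℤ) ↔
      (n = 1 ∧ m = 0) ∨ (3 ≤ k ∧ n = 0 ∧ m = 2) ∨ (k = 2 ∧ n = 0 ∧ m = 3) := by
  obtain ⟨t, rfl⟩ := Nat.exists_eq_add_of_le' hk
  set a : ℕ → ℤ := fun n => lucasAux (t + 2) (t + n)
  have hcast : ∀ n : ℕ, genLucas (t + 2) (n : ℤ) = a n := genLucas_natCast t
  have a0 : a 0 = 2 := lucasAux_zero t
  have a1 : a 1 = 1 := lucasAux_one t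
  have a2 : a 2 = 3 := lucasAux_two t
  have hadd : ∀ n, a (n + 1) + a n ≤ a (n + 2) := lucasAux_add_le t
  obtain ⟨hpos, hmono⟩ := pos_and_strictMono_of_add_le a0 a1 hadd
  have hinj : ∀ i j, 1 ≤ i → 1 ≤ j → a i = a j → i = j := by
    intro i j hi hj hij
    obtain ⟨i, rfl⟩ := Nat.exists_eq_add_of_le' hi
    obtain ⟨j, rfl⟩ := Nat.exists_eq_add_of_le' hj
    rw [hmono.injective hij]
  have hge : ∀ j, 2 ≤ j → 3 ≤ a j := by
    intro j hj
    obtain ⟨j, rfl⟩ := Nat.exists_eq_add_of_le' hj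
    rw [← a2]
    exact hmono.monotone (show 1 ≤ j + 1 by omega)
  have hsucc : genLucas (t + 2) ((n : ℤ) + 1) = a (n + 1) := by exact_mod_cast hcast (n + 1)
  rw [hsucc, hcast, hcast]
  match n with
  | 0 =>
    have hm : m = 0 ∨ 1 ≤ m := by omega
    rcases Nat.eq_zero_or_pos t with rfl | ht
    · have a3 : a 3 = 4 := by
        have h := lucasAux_add_two 0 1
        simp only [Finset.range_zero, Finset.sum_empty, add_zero] at h
        change a 3 = a 2 + a 1 at h
        rw [h, a2, a1]; rfl
      have hneg : genLucas (0 + 2) (((0 : ℕ) : ℤ) - 1) = -1 := genLucas_two_neg_one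
      rw [hneg, zero_add, a1, a0]
      constructor
      · intro h
        rcases hm with rfl | hm
        · omega
        · have := hinj 3 m (by omega) hm (by omega)
          omega
      · intro h
        obtain rfl : m = 3 := by omega
        omega
    · have hneg : genLucas (t + 2) (((0 : ℕ) : ℤ) - 1) = 0 := genLucas_neg_one t ht
      rw [hneg, zero_add, a1, a0]
      constructor
      · intro h
        rcases hm with rfl | hm
        · omega
        · have := hinj 2 m (by omega) hm (by omega)
          omega
      · intro h
        obtain rfl : m = 2 := by omega
        omega
  | 1 =>
    have hpred : genLucas (t + 2) (((1 : ℕ) : ℤ) - 1) = a 0 := hcast 0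
    rw [hpred, a0, a1, a2]
    constructor
    · intro h
      have h1 : m ≠ 1 := by rintro rfl; omega
      have h2 : ¬ 2 ≤ m := fun h2 => by have := hge m h2; omega
      omega
    · intro h
      obtain rfl : m = 0 := by omega
      omega
  | n + 2 =>
    have hpred : genLucas (t + 2) (((n + 2 : ℕ) : ℤ) - 1) = a (n + 1) := by
      rw [← hcast]; congr 1; push_cast; ring
    rw [hpred]
    refine ⟨fun h => ?_, fun h => by omega⟩
    exfalso
    have hlow : a (n + 3) < a m := by
      have : a (n + 1) < a (n + 2) := hmono (Nat.lt_succ_self n)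
      rw [← h]; linarith
    have hup : a m < a (n + 4) := by
      rw [← h]; linarith [hadd (n + 2), hpos (n + 1)]
    rcases Nat.eq_zero_or_pos m with rfl | hm
    · linarith [hge (n + 3) (by omega)]
    · obtain ⟨m, rfl⟩ := Nat.exists_eq_add_of_le' hm
      have h1 : n + 2 < m := hmono.lt_iff_lt.1 hlow
      have h2 : m < n + 3 := hmono.lt_iff_lt.1 hup
      omega
end

section
/- Let (L_n) denote the classical Lucas sequence (L_0 = 2, L_1 = 1, L_n = L_{n−1} + L_{n−2}). For every integer x ≥ 2, one has 2 + ((−1)^x − 1)·L_x − L_{2x} + (−1)^x ∉ {1, −1}; equivalently, writing α = (1 + √5)/2 and β = (1 − √5)/2, (α^{2x} + α^x − 1)(β^{2x} + β^x − 1) ≠ ±1. -/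
/-- The classical Lucas sequence: `L_0 = 2`, `L_1 = 1`, `L_n = L_{n-1} + L_{n-2}`. -/
def lucasSeq : ℕ → ℤ
  | 0 => 2
  | 1 => 1
  | n + 2 => lucasSeq (n + 1) + lucasSeq n

theorem lucasSeq_pos : ∀ n, 0 < lucasSeq n
  | 0 => by norm_num [lucasSeq]
  | 1 => by norm_num [lucasSeq]
  | n + 2 => by
    rw [lucasSeq]
    exact add_pos (lucasSeq_pos (n + 1)) (lucasSeq_pos n)

theorem seven_le_lucasSeq_add_four : ∀ n, 7 ≤ lucasSeq (n + 4)
  | 0 => by norm_num [lucasSeq]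
  | n + 1 => by
    rw [show n + 1 + 4 = n + 3 + 2 by ring, lucasSeq]
    have := seven_le_lucasSeq_add_four n
    have := lucasSeq_pos (n + 3)
    linarith

/-- The Binet formula, for the two roots of `X ^ 2 - X - 1` in any commutative ring. -/
theorem lucasSeq_eq_pow_add_pow {R : Type*} [CommRing R] {a b : R} (hadd : a + b = 1)
    (ha : a ^ 2 = a + 1) (hb : b ^ 2 = b + 1) : ∀ n, (lucasSeq n : R) = a ^ n + b ^ n
  | 0 => by norm_num [lucasSeq]
  | 1 => by simp [lucasSeq, hadd]
  | n + 2 => by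
    rw [lucasSeq, Int.cast_add, lucasSeq_eq_pow_add_pow hadd ha hb (n + 1),
      lucasSeq_eq_pow_add_pow hadd ha hb n, pow_add a n 2, pow_add b n 2, ha, hb]
    ring

theorem lucas_product_eq {R : Type*} [CommRing R] {a b : R} (hadd : a + b = 1)
    (hmul : a * b = -1) (n : ℕ) :
    (a ^ (2 * n) + a ^ n - 1) * (b ^ (2 * n) + b ^ n - 1) =
      ((2 + ((-1) ^ n - 1) * lucasSeq n - lucasSeq (2 * n) + (-1) ^ n : ℤ) : R) := by
  have ha : a ^ 2 = a + 1 := by linear_combination a * hadd - hmul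
  have hb : b ^ 2 = b + 1 := by linear_combination b * hadd - hmul
  have hpow : a ^ n * b ^ n = (-1) ^ n := by rw [← mul_pow, hmul]
  have hsq : ((-1 : R) ^ n) ^ 2 = 1 := by rw [← pow_mul, mul_comm, pow_mul]; simp
  push_cast
  rw [lucasSeq_eq_pow_add_pow hadd ha hb, lucasSeq_eq_pow_add_pow hadd ha hb,
    mul_comm 2 n, pow_mul, pow_mul]
  linear_combination
    (a ^ n * b ^ n + (-1) ^ n + a ^ n + b ^ n + 1) * hpow + hsq

theorem lucas_product_lt_neg_one {n : ℕ} (hn : 2 ≤ n) :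
    2 + ((-1) ^ n - 1) * lucasSeq n - lucasSeq (2 * n) + (-1) ^ n < -1 := by
  have h₁ := lucasSeq_pos n
  have h₂ := seven_le_lucasSeq_add_four (2 * n - 4)
  rw [Nat.sub_add_cancel (by omega)] at h₂
  rcases neg_one_pow_eq_or ℤ n with h | h <;> rw [h] <;> linarith

theorem lucas_product_ne_pm_one (x : ℕ) (hx : 2 ≤ x) :
    (2 + ((-1) ^ x - 1) * lucasSeq x - lucasSeq (2 * x) + (-1) ^ x ∉ ({1, -1} : Set ℤ)) ∧
      ((((1 + Real.sqrt 5) / 2) ^ (2 * x) + ((1 + Real.sqrt 5) / 2) ^ x - 1)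
          * (((1 - Real.sqrt 5) / 2) ^ (2 * x) + ((1 - Real.sqrt 5) / 2) ^ x - 1) ≠ 1 ∧
        (((1 + Real.sqrt 5) / 2) ^ (2 * x) + ((1 + Real.sqrt 5) / 2) ^ x - 1)
          * (((1 - Real.sqrt 5) / 2) ^ (2 * x) + ((1 - Real.sqrt 5) / 2) ^ x - 1) ≠ -1) := by
  have hlt := lucas_product_lt_neg_one hx
  have hsqrt : Real.sqrt 5 ^ 2 = 5 := Real.sq_sqrt (by norm_num)
  rw [lucas_product_eq (by ring) (by linear_combination -hsqrt / 4)]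
  refine ⟨?_, ?_, ?_⟩
  · rintro (h | h)
    · omega
    · exact hlt.ne h
  · exact_mod_cast (hlt.trans (by norm_num)).ne
  · exact_mod_cast hlt.ne
end
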